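/- For all n, m ≥ 1, the number of Schröder paths of semilength n with exactly n−m diagonal steps is the binomial transform in n of the numbers |RP(k,m)|: |SP(n,m)| = Σ_{k=1}^{n} binom(n−1, k−1)·|RP(k,m)|. -/

import Mathlib

/-! Schröder paths -/

inductive SStep : Type
  | H | V | D
deriving DecidableEq

def SStep.dx : SStep → ℕ
  | .H => 1 | .V => 0 | .D => 1

def SStep.dy : SStep → ℕ
  | .H => 0 | .V => 1 | .D => 1

def pathX (p : List SStep) : ℕ := (p.map SStep.dx).sum
def pathY (p : List SStep) : ℕ := (p.map SStep.dy).sum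

/-- A Schröder path of semilength `n`: from (0,0) to (n,n), steps H,V,D,
never rising above the diagonal. -/
def IsSchroder (n : ℕ) (p : List SStep) : Prop :=
  pathX p = n ∧ pathY p = n ∧ ∀ q : List SStep, q <+: p → pathY q ≤ pathX q

/-- No diagonal step starts on the diagonal. -/
def DiagFree (p : List SStep) : Prop :=
  ∀ q r : List SStep, p = q ++ SStep.D :: r → pathX q ≠ pathY q

/-- Every diagonal step is immediately followed by a horizontal step,
except if it is the last step. -/
def DFollowedByH (p : List SStep) : Prop :=
  ∀ q r : List SStep, p = q ++ SStep.D :: r → r = [] ∨ ∃ r' : List SStep, r = SStep.H :: r'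

def SP (n m : ℕ) : Type := {p : List SStep // IsSchroder n p ∧ p.count SStep.D + m = n}
def SPplus (n m : ℕ) : Type :=
  {p : List SStep // IsSchroder n p ∧ p.count SStep.D + m = n ∧ DiagFree p}
def SPzero (n m : ℕ) : Type :=
  {p : List SStep // IsSchroder n p ∧ p.count SStep.D + m = n ∧ ¬ DiagFree p}
def RP (n m : ℕ) : Type :=
  {p : List SStep // IsSchroder n p ∧ p.count SStep.D + m = n ∧ DFollowedByH p}

/-! Rooted planar trees -/

inductive PTree : Type
  | node : List PTree → PTree

namespace PTree

def leaves : PTree → ℕ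
  | node [] => 1
  | node (c :: cs) => ((c :: cs).attach.map fun x => leaves x.1).sum
decreasing_by
  have := List.sizeOf_lt_of_mem x.2
  simp only [PTree.node.sizeOf_spec, List.cons.sizeOf_spec] at this ⊢
  omega

def internal : PTree → ℕ
  | node [] => 0
  | node (c :: cs) => 1 + ((c :: cs).attach.map fun x => internal x.1).sum
decreasing_by
  have := List.sizeOf_lt_of_mem x.2
  simp only [PTree.node.sizeOf_spec, List.cons.sizeOf_spec] at this ⊢
  omega

def Good : PTree → Prop
  | node cs => cs.length ≠ 1 ∧ ∀ c ∈ cs.attach, Good c.1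
decreasing_by
  have := List.sizeOf_lt_of_mem c.2
  simp only [PTree.node.sizeOf_spec] at this ⊢
  omega

end PTree

def PT (n m : ℕ) : Type :=
  {t : PTree // t.Good ∧ t.leaves = n + 1 ∧ t.internal = m}

def PTn (n : ℕ) : Type := {t : PTree // t.Good ∧ t.leaves = n + 1}

/-! Motzkin paths -/

inductive MStep : Type
  | U | H | D
deriving DecidableEq

def MStep.dh : MStep → ℤ
  | .U => 1 | .H => 0 | .D => -1

def mHeight (p : List MStep) : ℤ := (p.map MStep.dh).sum

def IsMotzkin (k : ℕ) (p : List MStep) : Prop :=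
  p.length = k ∧ mHeight p = 0 ∧ ∀ q : List MStep, q <+: p → 0 ≤ mHeight q

def HFollowedByU (p : List MStep) : Prop :=
  ∀ q r : List MStep, p = q ++ MStep.H :: r → r = [] ∨ ∃ r' : List MStep, r = MStep.U :: r'

def MP (k : ℕ) : Type := {p : List MStep // IsMotzkin k p}
def RMP (k : ℕ) : Type := {p : List MStep // IsMotzkin k p ∧ HFollowedByU p}

/-- Motzkin steps with two possible colors on up and horizontal steps. -/
inductive CMStep : Type
  | U : Bool → CMStep
  | H : Bool → CMStep
  | D : CMStep
deriving DecidableEq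

def CMStep.forget : CMStep → MStep
  | .U _ => .U | .H _ => .H | .D => .D

/-- (h,u)-colored Motzkin paths of length n-1. -/
def huMP (n : ℕ) : Type := {p : List CMStep // IsMotzkin (n - 1) (p.map CMStep.forget)}


/-- The horizontal and vertical steps of a path, in order. -/
def stripD (p : List SStep) : List SStep := p.filter fun s => s ≠ SStep.D

@[simp] theorem stripD_nil : stripD [] = [] := rfl
@[simp] theorem stripD_cons_H (p : List SStep) : stripD (.H :: p) = .H :: stripD p := rfl
@[simp] theorem stripD_cons_V (p : List SStep) : stripD (.V :: p) = .V :: stripD p := rfl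
@[simp] theorem stripD_cons_D (p : List SStep) : stripD (.D :: p) = stripD p := rfl

theorem not_mem_stripD (p : List SStep) : SStep.D ∉ stripD p := by simp [stripD]

theorem pathX_eq_stripD (p : List SStep) : pathX p = pathX (stripD p) + p.count .D := by
  induction p with
  | nil => rfl
  | cons s p ih => cases s <;> simp_all [pathX, SStep.dx] <;> omega

theorem pathY_eq_stripD (p : List SStep) : pathY p = pathY (stripD p) + p.count .D := by
  induction p with
  | nil => rfl
  | cons s p ih => cases s <;> simp_all [pathY, SStep.dy] <;> omega

theorem isSchroder_iff_stripD (m : ℕ) (p : List SStep) :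
    IsSchroder (p.count .D + m) p ↔ IsSchroder m (stripD p) := by
  unfold IsSchroder
  rw [pathX_eq_stripD p, pathY_eq_stripD p]
  refine and_congr (by omega) (and_congr (by omega) ⟨fun h q hq => ?_, fun h q hq => ?_⟩)
  · obtain ⟨l, hl, rfl⟩ := List.prefix_filter_iff.1 hq
    have := h l hl
    rw [pathX_eq_stripD l, pathY_eq_stripD l] at this
    exact Nat.le_of_add_le_add_right this
  · have := h (stripD q) (hq.filter _)
    rw [pathX_eq_stripD q, pathY_eq_stripD q]
    omega

/-- Dyck words with `m` horizontal and `m` vertical steps. -/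
def dyckWords (m : ℕ) : Set (List SStep) := {w | SStep.D ∉ w ∧ IsSchroder m w}

theorem count_H_and_length_of_mem_dyckWords {m : ℕ} {w : List SStep} (hw : w ∈ dyckWords m) :
    w.count .H = m ∧ w.length = 2 * m := by
  obtain ⟨hD, hx, hy, -⟩ := hw
  have key : ∀ w : List SStep, SStep.D ∉ w →
      pathX w = w.count .H ∧ w.length = pathX w + pathY w := by
    intro w
    induction w with
    | nil => simp [pathX, pathY]
    | cons s w ih =>
      cases s <;> simp_all [pathX, pathY, SStep.dx, SStep.dy] <;> omega
  have := key w hD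
  omega

theorem dFollowedByH_nil : DFollowedByH [] := by
  intro q r h
  simp at h

theorem dFollowedByH_cons (s : SStep) (p : List SStep) :
    DFollowedByH (s :: p) ↔
      (s = .D → p = [] ∨ ∃ r, p = SStep.H :: r) ∧ DFollowedByH p := by
  constructor
  · intro h
    refine ⟨fun hs => h [] p (by simp [hs]), fun q r hqr => h (s :: q) r (by simp [hqr])⟩
  · rintro ⟨h₁, h₂⟩ q r hqr
    cases q with
    | nil =>
      obtain ⟨rfl, rfl⟩ := List.cons.inj hqr
      exact h₁ rfl
    | cons t q => exact h₂ q r (List.cons.inj hqr).2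

/-- The ways to insert `d` diagonal steps into `w`. -/
def insertions (w : List SStep) (d : ℕ) : Set (List SStep) :=
  {p | stripD p = w ∧ p.count .D = d}

theorem encard_insertions (w : List SStep) (hw : SStep.D ∉ w) (d : ℕ) :
    (insertions w d).encard = ((w.length + d).choose d : ℕ) := by
  induction w generalizing d with
  | nil =>
    have : insertions [] d = {List.replicate d .D} := by
      ext p
      simp only [insertions, Set.mem_ofPred_eq, Set.mem_singleton_iff]
      constructor
      · rintro ⟨h, rfl⟩
        refine List.eq_replicate_iff.2 ⟨?_, ?_⟩
        · symm
          rw [List.count_eq_length]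
          intro s hs
          by_contra hne
          have : s ∈ stripD p := by simp [stripD, hs, Ne.symm hne]
          simp [h] at this
        · intro s hs
          by_contra hne
          have : s ∈ stripD p := by simp [stripD, hs, hne]
          simp [h] at this
      · rintro rfl
        simp [stripD]
    simp [this]
  | cons s w ih =>
    have hs : s ≠ .D := fun h => hw (by simp [h])
    have hw' : SStep.D ∉ w := fun h => hw (List.mem_cons_of_mem _ h)
    induction d with
    | zero =>
      have : insertions (s :: w) 0 = List.cons s '' insertions w 0 := by
        ext p
        rcases p with _ | ⟨t, p⟩
        · simp [insertions]
        · cases t <;> cases s <;> simp_all [insertions]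
      rw [this, (List.cons_injective).encard_image, ih hw']
      simp
    | succ d ihd =>
      have : insertions (s :: w) (d + 1) =
          List.cons .D '' insertions (s :: w) d ∪ List.cons s '' insertions w (d + 1) := by
        ext p
        rcases p with _ | ⟨t, p⟩
        · simp [insertions]
        · cases t <;> cases s <;> simp_all [insertions]
      rw [this, Set.encard_union_eq, (List.cons_injective).encard_image,
        (List.cons_injective).encard_image, ih hw', ihd, ← Nat.cast_add, List.length_cons,
        show w.length + 1 + (d + 1) = (w.length + 1 + d) + 1 by ring, Nat.choose_succ_succ,
        show w.length + (d + 1) = w.length + 1 + d by ring]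
      rw [Set.disjoint_left]
      rintro _ ⟨p, -, rfl⟩ ⟨q, -, h⟩
      exact hs (List.cons.inj h).1

theorem encard_insertions_dFollowedByH (w : List SStep) (hw : SStep.D ∉ w) (d : ℕ) :
    (insertions w d ∩ {p | DFollowedByH p}).encard = ((w.count .H + 1).choose d : ℕ) := by
  induction w generalizing d with
  | nil =>
    have key : ∀ p, stripD p = [] → DFollowedByH p → p = [] ∨ p = [.D] := by
      rintro (_ | ⟨s, p⟩) h₁ h₂
      · simp
      · cases s <;> simp at h₁
        obtain rfl | ⟨r, rfl⟩ := ((dFollowedByH_cons _ _).1 h₂).1 rfl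
        · simp
        · simp at h₁
    rcases d with _ | _ | d
    · have : insertions [] 0 ∩ {p | DFollowedByH p} = {[]} := by
        ext p
        constructor
        · rintro ⟨⟨h₁, h₂⟩, h₃⟩
          rcases key p h₁ h₃ with rfl | rfl <;> simp_all
        · rintro rfl
          exact ⟨⟨rfl, rfl⟩, dFollowedByH_nil⟩
      simp [this]
    · have : insertions [] 1 ∩ {p | DFollowedByH p} = {[.D]} := by
        ext p
        constructor
        · rintro ⟨⟨h₁, h₂⟩, h₃⟩
          rcases key p h₁ h₃ with rfl | rfl <;> simp_all
        · rintro rfl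
          exact ⟨⟨rfl, rfl⟩, (dFollowedByH_cons _ _).2 ⟨by simp, dFollowedByH_nil⟩⟩
      simp [this]
    · have : insertions [] (d + 2) ∩ {p | DFollowedByH p} = ∅ := by
        ext p
        refine iff_of_false ?_ (by simp)
        rintro ⟨⟨h₁, h₂⟩, h₃⟩
        rcases key p h₁ h₃ with rfl | rfl <;> simp at h₂
      simp [this, Nat.choose_eq_zero_of_lt]
  | cons s w ih =>
    have hw' : SStep.D ∉ w := fun h => hw (List.mem_cons_of_mem _ h)
    cases s with
    | D => simp at hw
    | V =>
      have : insertions (.V :: w) d ∩ {p | DFollowedByH p} =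
          List.cons .V '' (insertions w d ∩ {p | DFollowedByH p}) := by
        ext p
        rcases p with _ | ⟨t, p⟩
        · simp [insertions]
        · cases t
          · simp [insertions]
          · simp [insertions, dFollowedByH_cons]
          · simp only [insertions, dFollowedByH_cons, Set.mem_inter_iff, Set.mem_ofPred_eq]
            refine iff_of_false ?_ (by simp)
            rintro ⟨⟨h, -⟩, h', -⟩
            obtain rfl | ⟨r, rfl⟩ := h' trivial <;> simp at h
      rw [this, (List.cons_injective).encard_image, ih hw']
      simp
    | H =>
      cases d with
      | zero =>
        have : insertions (.H :: w) 0 ∩ {p | DFollowedByH p} =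
            List.cons .H '' (insertions w 0 ∩ {p | DFollowedByH p}) := by
          ext p
          rcases p with _ | ⟨t, p⟩
          · simp [insertions]
          · cases t <;> simp [insertions, dFollowedByH_cons]
        rw [this, (List.cons_injective).encard_image, ih hw']
        simp
      | succ d =>
        have : insertions (.H :: w) (d + 1) ∩ {p | DFollowedByH p} =
            (fun p => .D :: .H :: p) '' (insertions w d ∩ {p | DFollowedByH p}) ∪
              List.cons .H '' (insertions w (d + 1) ∩ {p | DFollowedByH p}) := by
          ext p
          rcases p with _ | ⟨t, p⟩
          · simp [insertions]
          · cases t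
            · simp [insertions, dFollowedByH_cons]
            · simp [insertions]
            · rcases p with _ | ⟨t, p⟩
              · simp [insertions]
              · cases t <;> simp [insertions, dFollowedByH_cons]
        rw [this, Set.encard_union_eq, (List.cons_injective).encard_image,
          Function.Injective.encard_image (fun p q h => by simpa using h), ih hw', ih hw',
          ← Nat.cast_add, List.count_cons_self, Nat.choose_succ_succ (w.count .H + 1)]
        rw [Set.disjoint_left]
        rintro _ ⟨p, -, rfl⟩ ⟨q, -, h⟩
        simp at h

theorem Nat.card_eq_mul_of_encard_fiber {α β : Type*} {S : Set α} {T : Set β} (f : α → β)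
    (hf : Set.MapsTo f S T) (N : ℕ) (h : ∀ b ∈ T, {a | a ∈ S ∧ f a = b}.encard = N) :
    Nat.card S = Nat.card T * N := by
  have key : ∀ b : T, Nonempty ({a : S // hf.restrict f S T a = b} ≃ Fin N) := by
    intro b
    have hb := h b b.2
    have : Finite {a | a ∈ S ∧ f a = b} := Set.finite_of_encard_eq_coe hb
    have e : {a : S // hf.restrict f S T a = b} ≃ {a | a ∈ S ∧ f a = b} :=
      (Equiv.subtypeEquivRight fun a => by simp [Subtype.ext_iff]).trans
        (Equiv.subtypeSubtypeEquivSubtypeInter (· ∈ S) (fun a => f a = b))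
    refine ⟨e.trans (Finite.equivFinOfCardEq ?_)⟩
    rw [Nat.card_coe_set_eq, Set.ncard_def, hb]
    rfl
  have e := fun b => (key b).some
  rw [Nat.card_congr ((Equiv.sigmaFiberEquiv (hf.restrict f S T)).symm.trans
    ((Equiv.sigmaCongrRight e).trans (Equiv.sigmaEquivProd T (Fin N)))), Nat.card_prod,
    Nat.card_fin]

theorem isSchroder_and_count_iff (d m : ℕ) (p : List SStep) :
    (IsSchroder (m + d) p ∧ p.count .D + m = m + d) ↔
      stripD p ∈ dyckWords m ∧ p.count .D = d := by
  constructor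
  · rintro ⟨h₁, h₂⟩
    have hd : p.count .D = d := by omega
    rw [← h₂, isSchroder_iff_stripD] at h₁
    exact ⟨⟨not_mem_stripD p, h₁⟩, hd⟩
  · rintro ⟨⟨-, h⟩, rfl⟩
    rw [add_comm m, isSchroder_iff_stripD]
    exact ⟨h, rfl⟩

theorem card_SP_add (m d : ℕ) :
    Nat.card (SP (m + d) m) = Nat.card (dyckWords m) * (2 * m + d).choose d := by
  refine Nat.card_eq_mul_of_encard_fiber
    (S := {p | IsSchroder (m + d) p ∧ p.count .D + m = m + d}) stripD ?_ _ ?_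
  · exact fun p hp => ((isSchroder_and_count_iff d m p).1 hp).1
  · intro w hw
    rw [← (count_H_and_length_of_mem_dyckWords hw).2, ← encard_insertions w hw.1]
    congr 1
    ext p
    simp only [Set.mem_ofPred_eq, isSchroder_and_count_iff, insertions]
    constructor
    · rintro ⟨⟨-, h⟩, h'⟩
      exact ⟨h', h⟩
    · rintro ⟨rfl, h⟩
      exact ⟨⟨hw, h⟩, rfl⟩

theorem card_RP_add (m d : ℕ) :
    Nat.card (RP (m + d) m) = Nat.card (dyckWords m) * (m + 1).choose d := by
  refine Nat.card_eq_mul_of_encard_fiber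
    (S := {p | IsSchroder (m + d) p ∧ p.count .D + m = m + d ∧ DFollowedByH p}) stripD ?_ _ ?_
  · exact fun p hp => ((isSchroder_and_count_iff d m p).1 ⟨hp.1, hp.2.1⟩).1
  · intro w hw
    have hH := encard_insertions_dFollowedByH w hw.1 d
    rw [(count_H_and_length_of_mem_dyckWords hw).1] at hH
    rw [← hH]
    congr 1
    ext p
    simp only [Set.mem_ofPred_eq, ← and_assoc, isSchroder_and_count_iff, insertions,
      Set.mem_inter_iff]
    constructor
    · rintro ⟨⟨⟨-, h⟩, hp⟩, h'⟩
      exact ⟨⟨h', h⟩, hp⟩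
    · rintro ⟨⟨rfl, h⟩, hp⟩
      exact ⟨⟨⟨hw, h⟩, hp⟩, rfl⟩

theorem card_SP_of_lt {n m : ℕ} (h : n < m) : Nat.card (SP n m) = 0 := by
  have : IsEmpty (SP n m) := ⟨fun p => by have := p.2.2; omega⟩
  exact Nat.card_of_isEmpty

theorem card_RP_of_lt {n m : ℕ} (h : n < m) : Nat.card (RP n m) = 0 := by
  have : IsEmpty (RP n m) := ⟨fun p => by have := p.2.2.1; omega⟩
  exact Nat.card_of_isEmpty

/-- |SP(n,m)| = Σ_{k=1}^{n} binom(n−1,k−1)·|RP(k,m)|. -/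
theorem statement11 (n m : ℕ) (hn : 1 ≤ n) (hm : 1 ≤ m) :
    Nat.card (SP n m) = ∑ k ∈ Finset.Icc 1 n, (n - 1).choose (k - 1) * Nat.card (RP k m) := by
  rcases lt_or_ge n m with hlt | hle
  · rw [card_SP_of_lt hlt, Finset.sum_eq_zero]
    intro k hk
    rw [card_RP_of_lt ((Finset.mem_Icc.1 hk).2.trans_lt hlt), mul_zero]
  obtain ⟨d, rfl⟩ := Nat.exists_eq_add_of_le hle
  have hsub : Finset.Ico m (m + d + 1) ⊆ Finset.Icc 1 (m + d) := by
    intro k hk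
    simp only [Finset.mem_Ico, Finset.mem_Icc] at hk ⊢
    omega
  rw [← Finset.sum_subset hsub, Finset.sum_Ico_eq_sum_range, card_SP_add,
    show 2 * m + d = (m + 1) + (m + d - 1) by omega, Nat.add_choose_eq,
    Finset.Nat.sum_antidiagonal_eq_sum_range_succ_mk, Finset.mul_sum,
    show m + d + 1 - m = d.succ by omega]
  · refine Finset.sum_congr rfl fun j hj => ?_
    have hj' : j ≤ d := Nat.lt_succ_iff.1 (Finset.mem_range.1 hj)
    rw [card_RP_add, Nat.choose_symm_of_eq_add (show m + d - 1 = (d - j) + (m + j - 1) by omega)]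
    ring
  · intro k hk hk'
    simp only [Finset.mem_Ico, Finset.mem_Icc] at hk hk'
    rw [card_RP_of_lt (by omega), mul_zero]
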